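/- Let ρ_P be a Bell diagonal state in equal local dimensions d with Fourier coefficients λ_{μν}. Then ρ_P is invariant under partial transposition, ρ_P = ρ_P^{T_A}, if and only if: (i) λ_{μν} = 0 for every μ with 2μ ≢ 0 (mod d), and (ii) if d is even, λ_{d/2, ν} = 0 for every odd ν. -/

import Mathlib

open Matrix Complex Finset
open scoped Kronecker ComplexOrder

noncomputable section

/-- The primitive `d`-th root of unity `ω = exp(2πi/d)`. -/
def omg (d : ℕ) : ℂ := Complex.exp (2 * Real.pi * Complex.I / d)

/-- The shift operator `X|i⟩ = |i ⊕ 1⟩` (addition mod `d`). -/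
def shiftX (d : ℕ) : Matrix (Fin d) (Fin d) ℂ :=
  Matrix.of fun i j => if (i : ℕ) = ((j : ℕ) + 1) % d then 1 else 0

/-- The clock operator `Z|i⟩ = ω^i |i⟩`. -/
def clockZ (d : ℕ) : Matrix (Fin d) (Fin d) ℂ :=
  Matrix.diagonal fun i => omg d ^ (i : ℕ)

/-- The modified clock operator on `ℂ^{dA}`, `Ẑ|i⟩ = ω_B^i |i⟩`. -/
def clockZmod (dA dB : ℕ) : Matrix (Fin dA) (Fin dA) ℂ :=
  Matrix.diagonal fun i => omg dB ^ (i : ℕ)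

/-- The generalized Bell state `|φ^{00}⟩ = (1/√dA) ∑ᵢ |i⟩⊗|i⟩`. -/
def bell00 (dA dB : ℕ) : Fin dA × Fin dB → ℂ :=
  fun p => if (p.2 : ℕ) = (p.1 : ℕ) then ((1 / Real.sqrt dA : ℝ) : ℂ) else 0

/-- The generalized Bell state `|φ^{αβ}⟩ = (Z_A^α ⊗ X_B^β)|φ^{00}⟩`. -/
def bell (dA dB : ℕ) (α β : ℕ) : Fin dA × Fin dB → ℂ :=
  Matrix.mulVec ((clockZ dA ^ α) ⊗ₖ (shiftX dB ^ β)) (bell00 dA dB)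

/-- The outer product `|v⟩⟨v|`. -/
def outer {n : Type*} [Fintype n] (v : n → ℂ) : Matrix n n ℂ :=
  Matrix.of fun i j => v i * (starRingEnd ℂ) (v j)

/-- The Bell diagonal state `ρ_P = ∑_{αβ} p_{αβ} |φ^{αβ}⟩⟨φ^{αβ}|`. -/
def rhoBDS (dA dB : ℕ) (p : Fin dA → Fin dB → ℝ) :
    Matrix (Fin dA × Fin dB) (Fin dA × Fin dB) ℂ :=
  ∑ α : Fin dA, ∑ β : Fin dB, (p α β : ℂ) • outer (bell dA dB (α : ℕ) (β : ℕ))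

/-- The Fourier coefficients `λ_{μν} = ∑_{αβ} p_{αβ} ω_A^{αμ} ω_B^{βν}`. -/
def lam (dA dB : ℕ) (p : Fin dA → Fin dB → ℝ) (μ ν : ℕ) : ℂ :=
  ∑ α : Fin dA, ∑ β : Fin dB,
    (p α β : ℂ) * omg dA ^ ((α : ℕ) * μ) * omg dB ^ ((β : ℕ) * ν)

/-- The partial transpose on subsystem `A`: `⟨ij|ρ^{T_A}|kl⟩ = ⟨kj|ρ|il⟩`. -/
def ptA {dA dB : ℕ} (ρ : Matrix (Fin dA × Fin dB) (Fin dA × Fin dB) ℂ) :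
    Matrix (Fin dA × Fin dB) (Fin dA × Fin dB) ℂ :=
  Matrix.of fun p q => ρ (q.1, p.2) (p.1, q.2)

/-- A bipartite density matrix is separable if it is a finite convex combination of
tensor products of density matrices. -/
def IsSepState {dA dB : ℕ} (σ : Matrix (Fin dA × Fin dB) (Fin dA × Fin dB) ℂ) : Prop :=
  ∃ (n : ℕ) (q : Fin n → ℝ) (a : Fin n → Matrix (Fin dA) (Fin dA) ℂ)
    (b : Fin n → Matrix (Fin dB) (Fin dB) ℂ),
    (∀ i, 0 ≤ q i) ∧ (∑ i, q i = 1) ∧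
    (∀ i, (a i).PosSemidef ∧ (a i).trace = 1) ∧
    (∀ i, (b i).PosSemidef ∧ (b i).trace = 1) ∧
    σ = ∑ i, (q i : ℂ) • (a i ⊗ₖ b i)

/-- The local unitaries `T(μ,ν) = X_A^μ Ẑ^ν ⊗ X_B^μ Z_B^{-ν}`. -/
def Tgate (dA dB : ℕ) (μ ν : ℕ) : Matrix (Fin dA × Fin dB) (Fin dA × Fin dB) ℂ :=
  (shiftX dA ^ μ * clockZmod dA dB ^ ν) ⊗ₖ (shiftX dB ^ μ * (clockZ dB ^ ν)ᴴ)

/-- The map `Φ_q(ρ) = (1-q)ρ + (q/(dA dB)) ∑_{μν} T(μ,ν) ρ T(μ,ν)†`. -/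
def Phi (dA dB : ℕ) (q : ℝ) (ρ : Matrix (Fin dA × Fin dB) (Fin dA × Fin dB) ℂ) :
    Matrix (Fin dA × Fin dB) (Fin dA × Fin dB) ℂ :=
  (1 - (q : ℂ)) • ρ + ((q : ℂ) / (dA * dB)) •
    ∑ μ : Fin dA, ∑ ν : Fin dB, Tgate dA dB (μ : ℕ) (ν : ℕ) * ρ * (Tgate dA dB (μ : ℕ) (ν : ℕ))ᴴ


lemma omg_isPrimitiveRoot (d : ℕ) [NeZero d] : IsPrimitiveRoot (omg d) d :=
  Complex.isPrimitiveRoot_exp d (NeZero.ne d)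

lemma omg_pow_mod (d : ℕ) [NeZero d] (n : ℕ) : omg d ^ (n % d) = omg d ^ n :=
  (pow_eq_pow_mod n (omg_isPrimitiveRoot d).pow_eq_one).symm

lemma omg_pow_ne_zero (d : ℕ) [NeZero d] (n : ℕ) : omg d ^ n ≠ 0 :=
  pow_ne_zero _ ((omg_isPrimitiveRoot d).ne_zero (NeZero.ne d))

lemma omg_pow_val_add {d : ℕ} [NeZero d] (a b : Fin d) :
    omg d ^ ((a + b : Fin d) : ℕ) = omg d ^ (a : ℕ) * omg d ^ (b : ℕ) := by
  rw [Fin.val_add, omg_pow_mod, pow_add]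

lemma omg_pow_val_sub {d : ℕ} [NeZero d] (a b : Fin d) :
    omg d ^ ((a - b : Fin d) : ℕ) = omg d ^ (a : ℕ) * (omg d ^ (b : ℕ))⁻¹ := by
  rw [eq_mul_inv_iff_mul_eq₀ (omg_pow_ne_zero d _), ← omg_pow_val_add, sub_add_cancel]

lemma conj_omg_pow (d : ℕ) [NeZero d] (n : ℕ) :
    (starRingEnd ℂ) (omg d ^ n) = (omg d ^ n)⁻¹ := by
  refine (Complex.inv_eq_conj ?_).symm
  rw [norm_pow, (omg_isPrimitiveRoot d).norm'_eq_one (NeZero.ne d), one_pow]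

lemma shiftX_pow_apply (d : ℕ) (n : ℕ) (i j : Fin d) :
    (shiftX d ^ n) i j = if (i : ℕ) = ((j : ℕ) + n) % d then 1 else 0 := by
  induction n generalizing i j with
  | zero => simp [Matrix.one_apply, Fin.ext_iff, Nat.mod_eq_of_lt j.isLt]
  | succ n ih =>
    have hd : 0 < d := j.pos
    rw [pow_succ, Matrix.mul_apply,
      Finset.sum_eq_single (⟨((j : ℕ) + 1) % d, Nat.mod_lt _ hd⟩ : Fin d)]
    · rw [ih]
      simp [shiftX, add_assoc, add_comm 1 n]
    · intro b _ hb
      have hb' : (b : ℕ) ≠ ((j : ℕ) + 1) % d := fun h => hb (Fin.ext h)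
      simp [shiftX, hb']
    · simp

lemma bell_apply {d : ℕ} [NeZero d] (α β i j : Fin d) :
    bell d d α β (i, j) =
      if j - i = β then omg d ^ ((α : ℕ) * (i : ℕ)) * ((1 / Real.sqrt d : ℝ) : ℂ) else 0 := by
  have hiff : ((j : ℕ) = ((i : ℕ) + (β : ℕ)) % d) ↔ j - i = β := by
    rw [← Fin.val_add, ← Fin.ext_iff, sub_eq_iff_eq_add']
  rw [bell, Matrix.mulVec, dotProduct, Finset.sum_eq_single (i, i)]
  · rw [Matrix.kroneckerMap_apply, shiftX_pow_apply, clockZ, Matrix.diagonal_pow]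
    simp only [hiff, bell00, Matrix.diagonal_apply_eq, Pi.pow_apply, if_true]
    split_ifs
    · rw [← pow_mul, mul_comm (i : ℕ), mul_one]
    · simp
  · rintro ⟨a, b⟩ - hab
    rw [Matrix.kroneckerMap_apply, clockZ, Matrix.diagonal_pow, bell00]
    by_cases h : a = i
    · subst h
      have hb : (b : ℕ) ≠ (a : ℕ) := fun h => hab (by rw [Fin.ext h])
      simp [hb]
    · simp [Matrix.diagonal_apply_ne _ (Ne.symm h)]
  · simp

/-- The Fourier transform of `p` in its first index only. -/
def partialFourier {d : ℕ} (p : Fin d → Fin d → ℝ) (m β : Fin d) : ℂ :=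
  ∑ α : Fin d, (p α β : ℂ) * omg d ^ ((α : ℕ) * (m : ℕ))

lemma rhoBDS_apply {d : ℕ} [NeZero d] (p : Fin d → Fin d → ℝ) (i j k l : Fin d) :
    rhoBDS d d p (i, j) (k, l) =
      if j - i = l - k then (d : ℂ)⁻¹ * partialFourier p (i - k) (j - i) else 0 := by
  have hsq : ((1 / Real.sqrt d : ℝ) : ℂ) * ((1 / Real.sqrt d : ℝ) : ℂ) = (d : ℂ)⁻¹ := by
    rw [← Complex.ofReal_mul, div_mul_div_comm, Real.mul_self_sqrt (Nat.cast_nonneg d)]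
    simp
  simp only [rhoBDS, Matrix.sum_apply, Matrix.smul_apply, outer, Matrix.of_apply, smul_eq_mul]
  have hinner : ∀ α : Fin d,
      ∑ β : Fin d, (p α β : ℂ) * (bell d d α β (i, j) * (starRingEnd ℂ) (bell d d α β (k, l))) =
      if j - i = l - k then
        (d : ℂ)⁻¹ * ((p α (j - i) : ℂ) * omg d ^ ((α : ℕ) * ((i - k : Fin d) : ℕ))) else 0 := by
    intro α
    rw [Finset.sum_eq_single (j - i)]
    · rw [bell_apply, bell_apply, if_pos rfl]
      by_cases h : j - i = l - k
      · rw [if_pos h.symm, if_pos h, map_mul, conj_omg_pow, Complex.conj_ofReal,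
          mul_comm (α : ℕ) ((i - k : Fin d) : ℕ), pow_mul _ ((i - k : Fin d) : ℕ),
          omg_pow_val_sub, ← hsq, mul_pow, inv_pow, ← pow_mul, ← pow_mul, mul_comm (i : ℕ),
          mul_comm (k : ℕ)]
        ring
      · rw [if_neg (Ne.symm h), if_neg h]
        simp
    · intro β _ hβ
      rw [bell_apply α β i j, if_neg (Ne.symm hβ)]
      simp
    · simp
  simp only [hinner]
  split_ifs
  · rw [partialFourier, Finset.mul_sum]
  · simp

lemma lam_eq_sum_partialFourier {d : ℕ} (p : Fin d → Fin d → ℝ) (m : Fin d) (ν : ℕ) :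
    lam d d p m ν = ∑ β : Fin d, partialFourier p m β * omg d ^ ((β : ℕ) * ν) := by
  simp only [lam, partialFourier, Finset.sum_mul]
  exact Finset.sum_comm

lemma eq_zero_of_fourier_eq_zero {d : ℕ} [NeZero d] (f : Fin d → ℂ)
    (hf : ∀ ν : Fin d, ∑ β : Fin d, f β * omg d ^ ((β : ℕ) * (ν : ℕ)) = 0) : f = 0 := by
  refine Matrix.eq_zero_of_forall_index_sum_pow_mul_eq_zero
    (f := fun ν : Fin d => omg d ^ (ν : ℕ)) ?_ ?_
  · intro a b hab
    exact Fin.ext ((omg_isPrimitiveRoot d).pow_inj a.isLt b.isLt hab)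
  · intro ν
    rw [← hf ν]
    refine Finset.sum_congr rfl fun β _ => ?_
    rw [← pow_mul, mul_comm, mul_comm (ν : ℕ)]

lemma fourier_translate {d : ℕ} [NeZero d] (f : Fin d → ℂ) (h : Fin d) (ν : ℕ) :
    omg d ^ ((h : ℕ) * ν) * ∑ β : Fin d, f (β + h) * omg d ^ ((β : ℕ) * ν) =
      ∑ β : Fin d, f β * omg d ^ ((β : ℕ) * ν) := by
  rw [← Equiv.sum_comp (Equiv.addRight h) fun β => f β * omg d ^ ((β : ℕ) * ν), Finset.mul_sum]
  refine Finset.sum_congr rfl fun β _ => ?_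
  simp only [Equiv.coe_addRight]
  rw [pow_mul _ ((β + h : Fin d) : ℕ), omg_pow_val_add, mul_pow, ← pow_mul, ← pow_mul]
  ring

lemma omg_pow_half {d : ℕ} [NeZero d] (hd : Even d) : omg d ^ (d / 2) = -1 := by
  obtain ⟨k, rfl⟩ := hd
  have hk : k ≠ 0 := by
    rintro rfl
    exact NeZero.ne (0 + 0) rfl
  have hdiv : (k + k) / 2 = k := by omega
  rw [hdiv]
  have hp := omg_isPrimitiveRoot (k + k)
  have hsq : omg (k + k) ^ k * omg (k + k) ^ k = 1 := by rw [← pow_add, hp.pow_eq_one]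
  refine (mul_self_eq_one_iff.mp hsq).resolve_left fun h => ?_
  exact hp.pow_ne_one_of_pos_of_lt hk (by omega) h

/-- A function on `Fin d`, `d` even, has period `d / 2` iff its Fourier transform vanishes at
every odd frequency. -/
lemma periodic_half_iff {d : ℕ} [NeZero d] (hd : Even d) (f : Fin d → ℂ) (h : Fin d)
    (hh : (h : ℕ) = d / 2) :
    (∀ β, f β = f (β + h)) ↔
      ∀ ν : Fin d, Odd (ν : ℕ) → ∑ β : Fin d, f β * omg d ^ ((β : ℕ) * (ν : ℕ)) = 0 := by
  have htr := fourier_translate f h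
  have hsign (ν : ℕ) : omg d ^ ((h : ℕ) * ν) = (-1) ^ ν := by
    rw [pow_mul, hh, omg_pow_half hd]
  simp only [hsign] at htr
  constructor
  · intro hper ν hν
    have := htr ν
    simp only [← hper, hν.neg_one_pow] at this
    linear_combination (-1 / 2 : ℂ) * this
  · intro hodd β
    have hzero : (fun β => f β - f (β + h)) = 0 := by
      refine eq_zero_of_fourier_eq_zero _ fun ν => ?_
      simp only [sub_mul, Finset.sum_sub_distrib]
      have := htr ν
      rcases Nat.even_or_odd (ν : ℕ) with hν | hν
      · rw [hν.neg_one_pow] at this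
        linear_combination -this
      · rw [hν.neg_one_pow, hodd ν hν] at this
        rw [hodd ν hν]
        linear_combination this
    exact sub_eq_zero.mp (congrFun hzero β)

lemma add_self_eq_zero_iff_dvd {d : ℕ} [NeZero d] (m : Fin d) :
    m + m = 0 ↔ d ∣ 2 * (m : ℕ) := by
  rw [Fin.ext_iff, Fin.val_add, Fin.val_zero, ← two_mul, Nat.dvd_iff_mod_eq_zero]

lemma pt_invariant_iff_partialFourier {d : ℕ} [NeZero d] (p : Fin d → Fin d → ℝ) :
    rhoBDS d d p = ptA (rhoBDS d d p) ↔
      (∀ m β : Fin d, m + m ≠ 0 → partialFourier p m β = 0) ∧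
      (∀ m β : Fin d, m + m = 0 → partialFourier p m β = partialFourier p m (β + m)) := by
  have hd : (d : ℂ)⁻¹ ≠ 0 := inv_ne_zero (Nat.cast_ne_zero.mpr (NeZero.ne d))
  constructor
  · intro hρ
    have key : ∀ m β : Fin d, partialFourier p m β =
        if m + m = 0 then partialFourier p m (β + m) else 0 := by
      intro m β
      have := congrFun (congrFun hρ (m, m + β)) (0, β)
      simp only [ptA, Matrix.of_apply, rhoBDS_apply] at this
      have hiff : m + β = β - m ↔ m + m = 0 := by
        rw [eq_sub_iff_add_eq, add_right_comm, add_eq_right]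
      simp only [add_sub_cancel_left, sub_zero, zero_sub, if_true, hiff] at this
      split_ifs at this ⊢ with h
      · rw [neg_eq_of_add_eq_zero_left h, add_comm m β] at this
        exact mul_left_cancel₀ hd this
      · exact (mul_eq_zero.mp this).resolve_left hd
    exact ⟨fun m β h => by rw [key, if_neg h], fun m β h => by rw [key m β, if_pos h]⟩
  · rintro ⟨hA, hB⟩
    ext ⟨i, j⟩ ⟨k, l⟩
    simp only [ptA, Matrix.of_apply, rhoBDS_apply]
    by_cases h : (i - k) + (i - k) = 0
    · have hneg : k - i = i - k := by
        rw [← neg_sub i k]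
        exact neg_eq_of_add_eq_zero_left h
      have h1 : j - k = j - i + (i - k) := by abel
      have h2 : l - i = l - k + (i - k) := by
        rw [← hneg]
        abel
      rw [hneg, h1, h2, ← hB _ _ h]
      simp only [add_left_inj]
    · have h' : (k - i) + (k - i) ≠ 0 := fun h0 => h (by
        rw [← neg_sub k i, ← neg_add, h0, neg_zero])
      rw [hA _ _ h, hA _ _ h']
      simp

/-- A Bell diagonal state of equal local dimensions is invariant under
partial transposition iff (i) `λ_{μν} = 0` whenever `2μ ≢ 0 (mod d)`, and
(ii) if `d` is even, `λ_{d/2,ν} = 0` for every odd `ν`. -/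
theorem pt_invariant_iff (d : ℕ) (p : Fin d → Fin d → ℝ)
    (hp : ∀ a b, 0 ≤ p a b) (hsum : ∑ a : Fin d, ∑ b : Fin d, p a b = 1) :
    rhoBDS d d p = ptA (rhoBDS d d p) ↔
      ((∀ μ ν : Fin d, ¬ (d ∣ 2 * (μ : ℕ)) → lam d d p (μ : ℕ) (ν : ℕ) = 0) ∧
       (Even d → ∀ ν : Fin d, Odd (ν : ℕ) → lam d d p (d / 2) (ν : ℕ) = 0)) := by
  have hd : NeZero d := ⟨by
    rintro rfl
    simp at hsum⟩
  rw [pt_invariant_iff_partialFourier]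
  refine and_congr ⟨fun h m ν hm => ?_, fun h m β hm => ?_⟩ ⟨fun h he => ?_, fun h m β hm => ?_⟩
  · rw [lam_eq_sum_partialFourier]
    refine Finset.sum_eq_zero fun β _ => ?_
    rw [h m β (mt (add_self_eq_zero_iff_dvd m).mp hm), zero_mul]
  · refine congrFun (eq_zero_of_fourier_eq_zero (partialFourier p m) fun ν => ?_) β
    rw [← lam_eq_sum_partialFourier]
    exact h m ν (mt (add_self_eq_zero_iff_dvd m).mpr hm)
  · let m : Fin d := ⟨d / 2, Nat.div_lt_self (Nat.pos_of_ne_zero hd.out) one_lt_two⟩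
    have hm : m + m = 0 := by
      rw [add_self_eq_zero_iff_dvd, Nat.two_mul_div_two_of_even he]
    intro ν hν
    have := (periodic_half_iff he (partialFourier p m) m rfl).mp (fun β => h m β hm) ν hν
    rwa [← lam_eq_sum_partialFourier] at this
  · rcases eq_or_ne m 0 with rfl | hm0
    · rw [add_zero]
    · have hval : 2 * (m : ℕ) = d := by
        obtain ⟨c, hc⟩ := (add_self_eq_zero_iff_dvd m).mp hm
        have hlt := m.isLt
        have hpos : (m : ℕ) ≠ 0 := fun h0 => hm0 (Fin.ext h0)
        have hc1 : c = 1 := by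
          have hc0 : c ≠ 0 := by
            rintro rfl
            omega
          have hc2 : c < 2 := by
            by_contra! h2
            nlinarith
          omega
        rw [hc, hc1, mul_one]
      have he : Even d := ⟨m, by omega⟩
      have hhalf : (m : ℕ) = d / 2 := by omega
      refine (periodic_half_iff he (partialFourier p m) m hhalf).mpr (fun ν hν => ?_) β
      rw [← lam_eq_sum_partialFourier, hhalf]
      exact h he ν hν


end
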